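/- arXiv:2210.08380 — 6 statements merged into one kernel-verified Lean document; each statement's English description precedes it below -/
import Mathlib

section
/- Block solution of the effective Lippmann–Schwinger equation (equations (32)–(33) of the paper): K ψ = S⁻¹ (K + μ·K G V K̄ R K̄) φ and K̄ ψ = R (K̄ φ + μ·K̄ G V K ψ). -/
open Filter Topology

/-- `R` is the inverse of `A` restricted to the range of the projection `E`:
`R` is supported on the range of `E`, `A` maps the range of `E` into itself,
and on that range `R` is a two-sided inverse of `A`. -/
def IsInvOn {H : Type*} [NormedAddCommGroup H] [InnerProductSpace ℂ H]
    (A R E : H →L[ℂ] H) : Prop :=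
  E ∘L R = R ∧ R ∘L E = R ∧ E ∘L A ∘L E = A ∘L E ∧ A ∘L R = E ∧ R ∘L A ∘L E = E

/-- Block solution of the effective Lippmann–Schwinger equation
(equations (32)–(33) of the paper):
`K ψ = S⁻¹ (K + μ·K G V K̄ R K̄) φ` and `K̄ ψ = R (K̄ φ + μ·K̄ G V K ψ)`. -/
theorem block_solution_LS
    {H : Type*} [NormedAddCommGroup H] [InnerProductSpace ℂ H] [CompleteSpace H]
    -- orthogonal projections `K`, `K̄` with `K ∘ K̄ = 0`; `P := K + K̄`
    (K Kbar : H →L[ℂ] H)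
    (hKsa : IsSelfAdjoint K) (hKidem : K ∘L K = K)
    (hKbarsa : IsSelfAdjoint Kbar) (hKbaridem : Kbar ∘L Kbar = Kbar)
    (hKKbar : K ∘L Kbar = 0)
    -- Green's operator and potential, supported on the range of `P = K + K̄`
    (G V : H →L[ℂ] H) (μ : ℂ)
    (hGsupp : (K + Kbar) ∘L G ∘L (K + Kbar) = G)
    (hVsupp : (K + Kbar) ∘L V ∘L (K + Kbar) = V)
    -- incoming state and scattering state
    (φ : H) (hφ : (K + Kbar) φ = φ)
    (ψ : H)
    (hLS : (K + Kbar) ψ = φ + μ • G (V ((K + Kbar) ψ)))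
    -- `R` inverts `K̄ − μ K̄ G V K̄` on the range of `K̄`
    (R : H →L[ℂ] H)
    (hR : IsInvOn (Kbar - μ • (Kbar ∘L G ∘L V ∘L Kbar)) R Kbar)
    -- `S⁻¹` inverts `S := K − μ K G V K − μ² K G V K̄ R K̄ G V K` on the range of `K`
    (Sinv : H →L[ℂ] H)
    (hS : IsInvOn (K - μ • (K ∘L G ∘L V ∘L K)
        - (μ ^ 2) • (K ∘L G ∘L V ∘L Kbar ∘L R ∘L Kbar ∘L G ∘L V ∘L K)) Sinv K) :
    K ψ = Sinv ((K + μ • (K ∘L G ∘L V ∘L Kbar ∘L R ∘L Kbar)) φ) ∧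
    Kbar ψ = R (Kbar φ + μ • (Kbar ∘L G ∘L V ∘L K) ψ) := by
  have hKbarK : Kbar ∘L K = 0 := by
    have h := congrArg star (show K * Kbar = 0 from hKKbar)
    rw [star_mul, hKsa.star_eq, hKbarsa.star_eq, star_zero] at h
    exact h
  have eKK (x : H) : K (K x) = K x := DFunLike.congr_fun hKidem x
  have eBB (x : H) : Kbar (Kbar x) = Kbar x := DFunLike.congr_fun hKbaridem x
  have eKB (x : H) : K (Kbar x) = 0 := DFunLike.congr_fun hKKbar x
  have eBK (x : H) : Kbar (K x) = 0 := DFunLike.congr_fun hKbarK x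
  have hK : K ψ = K φ + μ • K (G (V (K ψ))) + μ • K (G (V (Kbar ψ))) := by
    simpa [eKK, eKB, add_assoc] using congrArg K hLS
  have hKbar : Kbar ψ = Kbar φ + μ • Kbar (G (V (K ψ))) + μ • Kbar (G (V (Kbar ψ))) := by
    simpa [eBB, eBK, add_assoc] using congrArg Kbar hLS
  obtain ⟨hBR, -, -, -, hRA⟩ := hR
  obtain ⟨-, -, -, -, hSinv⟩ := hS
  have eBR (x : H) : Kbar (R x) = R x := DFunLike.congr_fun hBR x
  have hq : Kbar ψ = R (Kbar φ + μ • Kbar (G (V (K ψ)))) := by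
    rw [← sub_eq_iff_eq_add.mpr hKbar]
    simpa [eBB] using (DFunLike.congr_fun hRA ψ).symm
  refine ⟨?_, hq⟩
  refine (DFunLike.congr_fun hSinv ψ).symm.trans (congrArg Sinv ?_)
  have hKGVq := congrArg (fun x => μ • K (G (V x))) hq
  simp only [map_add, map_smul, smul_add, smul_smul] at hKGVq
  rw [hKGVq] at hK
  change K (K ψ) - μ • K (G (V (K (K ψ)))) -
      μ ^ 2 • K (G (V (Kbar (R (Kbar (G (V (K (K ψ))))))))) =
    K φ + μ • K (G (V (Kbar (R (Kbar φ)))))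
  simp only [eKK, eBR, pow_two]
  rw [sub_sub, sub_eq_iff_eq_add]
  refine hK.trans ?_
  abel
end

section
/- Lemma 1 (Taylor expansion of the effective potential): if P V₀ P = 0, then there is a constant C' with ‖V^eff_α − V^eff₀ − α·V^eff'₀‖ ≤ C'·α² for all α ∈ (0, α₀), where V^eff₀ := P V₀ Q G₀ Q V₀ P and V^eff'₀ := P V₀' P + P V₀' Q G₀ Q V₀ P + P V₀ Q G₀' Q V₀ P + P V₀ Q G₀ Q V₀' P. -/
open Filter Topology

open Asymptotics in
/-- First-order Taylor expansions with quadratic remainder multiply by the Leibniz rule, along any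
filter on which the parameter is bounded. -/
theorem isBigO_mul_sub_sub_smul_sq {A : Type*} [NormedRing A] [NormedAlgebra ℂ A]
    {l : Filter ℝ} (hl : (fun x : ℝ => (x : ℂ)) =O[l] (fun _ => (1 : ℝ)))
    {f g : ℝ → A} {a a' b b' : A}
    (hf : (fun x : ℝ => f x - a - (x : ℂ) • a') =O[l] (fun x => x ^ 2))
    (hg : (fun x : ℝ => g x - b - (x : ℂ) • b') =O[l] (fun x => x ^ 2)) :
    (fun x : ℝ => f x * g x - a * b - (x : ℂ) • (a' * b + a * b')) =O[l] (fun x => x ^ 2) := by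
  have affine (c c' : A) : (fun x : ℝ => c + (x : ℂ) • c') =O[l] (fun _ => (1 : ℝ)) := by
    refine (isBigO_const_const c one_ne_zero l).add ?_
    simpa using hl.smul (isBigO_const_const c' (one_ne_zero (α := ℝ)) l)
  have sq_bdd : (fun x : ℝ => x ^ 2) =O[l] (fun _ => (1 : ℝ)) := by
    have h : (fun x : ℝ => x) =O[l] (fun _ => (1 : ℝ)) :=
      (isBigO_of_le l fun x => by simp).trans hl
    simpa using h.pow 2
  have g_bdd : g =O[l] (fun _ => (1 : ℝ)) := by
    refine ((hg.trans sq_bdd).add (affine b b')).congr_left fun x => ?_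
    abel
  have h₁ : (fun x : ℝ => (f x - a - (x : ℂ) • a') * g x) =O[l] (fun x => x ^ 2) := by
    simpa using hf.mul g_bdd
  have h₂ : (fun x : ℝ => (a + (x : ℂ) • a') * (g x - b - (x : ℂ) • b')) =O[l]
      (fun x => x ^ 2) := by
    simpa using (affine a a').mul hg
  have h₃ : (fun x : ℝ => ((x : ℂ) ^ 2) • (a' * b')) =O[l] (fun x => x ^ 2) := by
    have h : (fun x : ℝ => (x : ℂ) ^ 2) =O[l] (fun x : ℝ => x ^ 2) :=
      isBigO_of_le l fun x => by simp
    simpa using h.smul (isBigO_const_const (a' * b') (one_ne_zero (α := ℝ)) l)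
  refine ((h₁.add h₂).add h₃).congr_left fun x => ?_
  simp only [sub_mul, mul_sub, add_mul, smul_mul_assoc, mul_smul_comm, smul_add,
    smul_smul, pow_two]
  abel

/-- Lemma 1 (Taylor expansion of the effective potential
`V^eff_α := P V_α P + P V_α Q G_α Q V_α P`): if `P V₀ P = 0`, then
`‖V^eff_α − V^eff₀ − α·V^eff'₀‖ ≤ C'·α²` on `(0, α₀)`, where
`V^eff₀ = P V₀ Q G₀ Q V₀ P` and
`V^eff'₀ = P V₀' P + P V₀' Q G₀ Q V₀ P + P V₀ Q G₀' Q V₀ P + P V₀ Q G₀ Q V₀' P`. -/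
theorem lemma1_effective_potential_taylor
    {H : Type*} [NormedAddCommGroup H] [InnerProductSpace ℂ H] [CompleteSpace H]
    -- complementary orthogonal projections `P`, `Q`
    (P Q : H →L[ℂ] H)
    (hPsa : IsSelfAdjoint P) (hPidem : P ∘L P = P)
    (hQsa : IsSelfAdjoint Q) (hQidem : Q ∘L Q = Q)
    (hPQ : P + Q = 1)
    (α₀ : ℝ) (hα₀ : 0 < α₀)
    -- self-adjoint potentials and Green's operators of the fast subsystem
    (V G : ℝ → (H →L[ℂ] H))
    (hVsa : ∀ α ∈ Set.Ioo (0:ℝ) α₀, IsSelfAdjoint (V α))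
    (hGsupp : ∀ α ∈ Set.Ioo (0:ℝ) α₀, Q ∘L (G α) ∘L Q = G α)
    -- Taylor coefficients
    (V₀ V₀' G₀ G₀' : H →L[ℂ] H) (C : ℝ)
    (hVT : ∀ α ∈ Set.Ioo (0:ℝ) α₀, ‖V α - V₀ - (α : ℂ) • V₀'‖ ≤ C * α ^ 2)
    (hGT : ∀ α ∈ Set.Ioo (0:ℝ) α₀, ‖G α - G₀ - (α : ℂ) • G₀'‖ ≤ C * α ^ 2)
    (hPV₀P : P ∘L V₀ ∘L P = 0) :
    ∃ C' : ℝ, ∀ α ∈ Set.Ioo (0:ℝ) α₀,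
      ‖(P ∘L (V α) ∘L P + P ∘L (V α) ∘L Q ∘L (G α) ∘L Q ∘L (V α) ∘L P)
          - P ∘L V₀ ∘L Q ∘L G₀ ∘L Q ∘L V₀ ∘L P
          - (α : ℂ) • (P ∘L V₀' ∘L P + P ∘L V₀' ∘L Q ∘L G₀ ∘L Q ∘L V₀ ∘L P
              + P ∘L V₀ ∘L Q ∘L G₀' ∘L Q ∘L V₀ ∘L P
              + P ∘L V₀ ∘L Q ∘L G₀ ∘L Q ∘L V₀' ∘L P)‖ ≤ C' * α ^ 2 := by
  open Asymptotics in
  set S := Set.Ioo (0 : ℝ) α₀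
  have hl : (fun x : ℝ => (x : ℂ)) =O[𝓟 S] (fun _ => (1 : ℝ)) :=
    isBigO_principal.2 ⟨α₀, fun x hx => by simpa [abs_of_pos hx.1] using hx.2.le⟩
  have const (T : H →L[ℂ] H) :
      (fun x : ℝ => T - T - (x : ℂ) • (0 : H →L[ℂ] H)) =O[𝓟 S] (fun x => x ^ 2) := by
    simpa using isBigO_zero (fun x : ℝ => x ^ 2) (𝓟 S)
  have hV : (fun x : ℝ => V x - V₀ - (x : ℂ) • V₀') =O[𝓟 S] (fun x => x ^ 2) :=
    isBigO_principal.2 ⟨C, fun x hx => by simpa using hVT x hx⟩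
  have hG : (fun x : ℝ => G x - G₀ - (x : ℂ) • G₀') =O[𝓟 S] (fun x => x ^ 2) :=
    isBigO_principal.2 ⟨C, fun x hx => by simpa using hGT x hx⟩
  have hVP := isBigO_mul_sub_sub_smul_sq hl hV (const P)
  have hPVP := isBigO_mul_sub_sub_smul_sq hl (const P) hVP
  have hGQVP := isBigO_mul_sub_sub_smul_sq hl hG
    (isBigO_mul_sub_sub_smul_sq hl (const Q) hVP)
  have hPVQGQVP := isBigO_mul_sub_sub_smul_sq hl (const P)
    (isBigO_mul_sub_sub_smul_sq hl hV (isBigO_mul_sub_sub_smul_sq hl (const Q) hGQVP))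
  obtain ⟨C', hC'⟩ := isBigO_principal.1 (hPVP.add hPVQGQVP)
  refine ⟨C', fun x hx => ?_⟩
  have key := hC' x hx
  rw [Real.norm_of_nonneg (sq_nonneg x)] at key
  refine le_of_eq_of_le (congrArg norm ?_) key
  simp only [← ContinuousLinearMap.mul_def] at hPV₀P ⊢
  simp only [hPV₀P, zero_mul, mul_zero, zero_add, add_zero, mul_add, smul_add, sub_zero]
  abel
end

section
/- Theorem 3(iv), abstract form (suppression of excitations at a resonantly driven impurity): ‖Q ψ_α‖ → 0 as α → 0⁺; in particular ‖Π ψ_α‖ → 0 and ‖(Q − Π) ψ_α‖ → 0, i.e. in the limit the scattering state vanishes in every copy of the fast subsystem of the extended Hilbert space. -/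
open Filter Topology

/-- If `A a → A₀` in operator norm, `x a` stays bounded and `A₀ (x a) → 0`, then
`A a (x a) → 0`. -/
theorem tendsto_norm_apply_zero_of_tendsto_norm_sub
    {𝕜 E F ι : Type*} [NontriviallyNormedField 𝕜] [SeminormedAddCommGroup E] [NormedSpace 𝕜 E]
    [SeminormedAddCommGroup F] [NormedSpace 𝕜 F] {l : Filter ι}
    {A : ι → (E →L[𝕜] F)} {A₀ : E →L[𝕜] F} {x : ι → E} {C : ℝ}
    (hA : Tendsto (fun a => ‖A a - A₀‖) l (𝓝 0)) (hx : ∀ᶠ a in l, ‖x a‖ ≤ C)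
    (hA₀ : Tendsto (fun a => ‖A₀ (x a)‖) l (𝓝 0)) :
    Tendsto (fun a => ‖A a (x a)‖) l (𝓝 0) := by
  have hbound : Tendsto (fun a => ‖A a - A₀‖ * C + ‖A₀ (x a)‖) l (𝓝 0) := by
    simpa using (hA.mul_const C).add hA₀
  refine squeeze_zero' (.of_forall fun _ => norm_nonneg _) ?_ hbound
  filter_upwards [hx] with a ha
  calc ‖A a (x a)‖ = ‖(A a - A₀) (x a) + A₀ (x a)‖ := by simp
    _ ≤ ‖(A a - A₀) (x a)‖ + ‖A₀ (x a)‖ := norm_add_le _ _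
    _ ≤ ‖A a - A₀‖ * C + ‖A₀ (x a)‖ := by
      gcongr
      exact (A a - A₀).le_opNorm_of_le ha

/-- A bounded operator preserves convergence to zero in norm. -/
theorem ContinuousLinearMap.tendsto_norm_apply_zero
    {𝕜 E F ι : Type*} [NontriviallyNormedField 𝕜] [SeminormedAddCommGroup E] [NormedSpace 𝕜 E]
    [SeminormedAddCommGroup F] [NormedSpace 𝕜 F] {l : Filter ι} {x : ι → E}
    (A : E →L[𝕜] F) (hx : Tendsto (fun a => ‖x a‖) l (𝓝 0)) :
    Tendsto (fun a => ‖A (x a)‖) l (𝓝 0) :=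
  squeeze_zero (fun _ => norm_nonneg _) (fun a => A.le_opNorm (x a))
    (by simpa using hx.const_mul ‖A‖)

/-- Theorem 3(iv) of the paper, abstract form (suppression of excitations at a
resonantly driven impurity): `‖Q ψ_α‖ → 0` as `α → 0⁺`; in particular `‖Π ψ_α‖ → 0`
and `‖(Q − Π) ψ_α‖ → 0`, i.e. in the limit the scattering state vanishes in every
copy of the fast subsystem of the extended Hilbert space. -/
theorem suppression_thm3_iv
    {H : Type*} [NormedAddCommGroup H] [InnerProductSpace ℂ H] [CompleteSpace H]
    -- orthogonal projections `Q`, `Π` (the resonant copy of the fast subsystem)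
    -- and `K`, with `Π ∘ Q = Q ∘ Π = Π` and `K ∘ Q = 0`
    (Q Pres K : H →L[ℂ] H)
    (hQsa : IsSelfAdjoint Q) (hQidem : Q ∘L Q = Q)
    (hPressa : IsSelfAdjoint Pres) (hPresidem : Pres ∘L Pres = Pres)
    (hKsa : IsSelfAdjoint K) (hKidem : K ∘L K = K)
    (hPresQ : Pres ∘L Q = Pres) (hQPres : Q ∘L Pres = Pres)
    (hKQ : K ∘L Q = 0)
    (α₀ : ℝ) (hα₀ : 0 < α₀)
    -- Green's operators, couplings and scattering states
    (G W : ℝ → (H →L[ℂ] H)) (ψ : ℝ → H)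
    (hGsupp : ∀ α ∈ Set.Ioo (0:ℝ) α₀, Q ∘L (G α) ∘L Q = G α)
    (hWsupp : ∀ α ∈ Set.Ioo (0:ℝ) α₀, Q ∘L (W α) = W α)
    (hψ : ∀ α ∈ Set.Ioo (0:ℝ) α₀,
      Q (ψ α) = (G α) ((W α) (((1 : H →L[ℂ] H) - Q) (ψ α))))
    -- the limiting Green's operator is supported on the resonant copy `Π`
    (G₀ : H →L[ℂ] H)
    (hGlim : Tendsto (fun α : ℝ => ‖G α - Pres ∘L G₀ ∘L Pres‖) (𝓝[>] (0:ℝ)) (𝓝 0))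
    -- the limiting coupling acts only through `K`
    (W₀ : H →L[ℂ] H)
    (hWlim : Tendsto (fun α : ℝ => ‖W α - W₀‖) (𝓝[>] (0:ℝ)) (𝓝 0))
    (hW₀K : W₀ ∘L K = W₀)
    -- uniform boundedness of `(1 − Q) ψ_α`
    (hbdd : ∃ Cb : ℝ, ∀ α ∈ Set.Ioo (0:ℝ) α₀, ‖((1 : H →L[ℂ] H) - Q) (ψ α)‖ ≤ Cb)
    -- the artificial boundary condition `‖K ψ_α‖ → 0`
    (hKψ : Tendsto (fun α : ℝ => ‖K (ψ α)‖) (𝓝[>] (0:ℝ)) (𝓝 0)) :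
    Tendsto (fun α : ℝ => ‖Q (ψ α)‖) (𝓝[>] (0:ℝ)) (𝓝 0) ∧
    Tendsto (fun α : ℝ => ‖Pres (ψ α)‖) (𝓝[>] (0:ℝ)) (𝓝 0) ∧
    Tendsto (fun α : ℝ => ‖(Q - Pres) (ψ α)‖) (𝓝[>] (0:ℝ)) (𝓝 0) := by
  obtain ⟨C, hC⟩ := hbdd
  have hIoo : ∀ᶠ α in 𝓝[>] (0:ℝ), α ∈ Set.Ioo (0:ℝ) α₀ := Ioo_mem_nhdsGT hα₀
  have hW₀ : ∀ v : H, W₀ (((1 : H →L[ℂ] H) - Q) v) = W₀ (K v) := by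
    intro v
    have hK : K (Q v) = 0 := congrArg (fun T : H →L[ℂ] H => T v) hKQ
    conv_lhs => rw [← hW₀K]
    simp [hK]
  have hWψ : Tendsto (fun α => ‖W α (((1 : H →L[ℂ] H) - Q) (ψ α))‖) (𝓝[>] (0:ℝ)) (𝓝 0) := by
    refine tendsto_norm_apply_zero_of_tendsto_norm_sub hWlim (hIoo.mono hC) ?_
    simp only [hW₀]
    exact W₀.tendsto_norm_apply_zero hKψ
  have hQψ : Tendsto (fun α => ‖Q (ψ α)‖) (𝓝[>] (0:ℝ)) (𝓝 0) := by
    refine (tendsto_norm_apply_zero_of_tendsto_norm_sub hGlim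
      (hWψ.eventually_le_const one_pos)
      (ContinuousLinearMap.tendsto_norm_apply_zero _ hWψ)).congr' ?_
    filter_upwards [hIoo] with α hα
    rw [hψ α hα]
  have hPQ : ∀ v : H, Pres (Q v) = Pres v := fun v =>
    congrArg (fun T : H →L[ℂ] H => T v) hPresQ
  have hQQ : ∀ v : H, Q (Q v) = Q v := fun v =>
    congrArg (fun T : H →L[ℂ] H => T v) hQidem
  refine ⟨hQψ, ?_, ?_⟩
  · simpa only [hPQ] using Pres.tendsto_norm_apply_zero hQψ
  · simpa only [sub_apply, hPQ, hQQ] using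
      (Q - Pres).tendsto_norm_apply_zero hQψ
end

section
/- Exact solution of the toy model (Section 3 and Appendix A): the pair (ψ_P, ψ_Q) is a generalized eigenfunction of the toy-model Hamiltonian with eigenvalue ε; that is, for every n ∈ ℤ with n ≠ 0: −J·(ψ_P(n−1) + ψ_P(n+1)) = ε·ψ_P(n) and −(J/α)·(ψ_Q(n−1) + ψ_Q(n+1)) = ε·ψ_Q(n), and at n = 0: −J·(ψ_P(−1) + ψ_P(1)) + (λ/α)·ψ_Q(0) = ε·ψ_P(0) and −(J/α)·(ψ_Q(−1) + ψ_Q(1)) + (λ/α)·ψ_P(0) = ε·ψ_Q(0). -/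
open Complex

/-- Adding the two neighbours multiplies a plane wave of momentum `q` by `2 cos q`. -/
theorem exp_sub_one_add_exp_add_one (q x : ℂ) :
    exp (I * q * (x - 1)) + exp (I * q * (x + 1)) = 2 * cos q * exp (I * q * x) := by
  have h₁ : I * q * (x - 1) = I * q * x + -q * I := by ring
  have h₂ : I * q * (x + 1) = I * q * x + q * I := by ring
  rw [h₁, h₂, exp_add, exp_add, two_cos]
  ring

theorem exp_neg_sub_one_add_exp_neg_add_one (q x : ℂ) :
    exp (-(I * q * (x - 1))) + exp (-(I * q * (x + 1))) = 2 * cos q * exp (-(I * q * x)) := by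
  simpa [cos_neg] using exp_sub_one_add_exp_add_one (-q) x

/-- Exact solution of the toy model (Section 3 and Appendix A of the paper): the pair
`(ψ_P, ψ_Q)` is a generalized eigenfunction, with eigenvalue `ε = −2J cos k`, of the
toy-model Hamiltonian consisting of two tight-binding chains `P` and `Q` with hopping
amplitudes `J` and `J/α` coupled at site `0` with amplitude `λ/α`, for an incoming
plane wave of momentum `k` in the slow chain `P`. -/
theorem toy_model_scattering_state
    (J lam : ℝ) (hJ : J ≠ 0) (α : ℝ) (hα : α ∈ Set.Ioo (0:ℝ) 1)
    (k kQ : ℝ) (hk : k ∈ Set.Ioo 0 Real.pi) (hkQ : kQ ∈ Set.Ioo 0 Real.pi)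
    (hres : Real.cos kQ = α * Real.cos k)
    (ε : ℝ) (hε : ε = -2 * J * Real.cos k)
    (tP r : ℝ)
    (htP : tP = 1 / (1 + lam ^ 2 / (4 * α * J ^ 2 * Real.sin k * Real.sin kQ)))
    (hr : r = tP - 1)
    (tQ : ℂ)
    (htQ : tQ = (lam : ℂ) * (tP : ℂ) / (2 * Complex.I * (J : ℂ) * (Real.sin kQ : ℂ)))
    (ψP ψQ : ℤ → ℂ)
    (hψP : ∀ n : ℤ, ψP n =
      if n ≤ 0 then
        Complex.exp (Complex.I * (k : ℂ) * (n : ℂ))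
          + (r : ℂ) * Complex.exp (-(Complex.I * (k : ℂ) * (n : ℂ)))
      else (tP : ℂ) * Complex.exp (Complex.I * (k : ℂ) * (n : ℂ)))
    (hψQ : ∀ n : ℤ, ψQ n = tQ * Complex.exp (Complex.I * (kQ : ℂ) * ((|n| : ℤ) : ℂ))) :
    (∀ n : ℤ, n ≠ 0 →
      -(J : ℂ) * (ψP (n - 1) + ψP (n + 1)) = (ε : ℂ) * ψP n ∧
      -((J : ℂ) / (α : ℂ)) * (ψQ (n - 1) + ψQ (n + 1)) = (ε : ℂ) * ψQ n) ∧
    -(J : ℂ) * (ψP (-1) + ψP 1) + ((lam : ℂ) / (α : ℂ)) * ψQ 0 = (ε : ℂ) * ψP 0 ∧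
    -((J : ℂ) / (α : ℂ)) * (ψQ (-1) + ψQ 1) + ((lam : ℂ) / (α : ℂ)) * ψP 0
      = (ε : ℂ) * ψQ 0 := by
  obtain ⟨hα0, -⟩ := hα
  have hs : 0 < Real.sin k := Real.sin_pos_of_mem_Ioo hk
  have hsQ : 0 < Real.sin kQ := Real.sin_pos_of_mem_Ioo hkQ
  have hαC : (α : ℂ) ≠ 0 := mod_cast hα0.ne'
  have hJC : (J : ℂ) ≠ 0 := mod_cast hJ
  have hsQC : sin (kQ : ℂ) ≠ 0 := mod_cast hsQ.ne'
  have hcos : cos (kQ : ℂ) = α * cos (k : ℂ) := mod_cast congrArg ofReal hres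
  have hεC : (ε : ℂ) = -2 * J * cos (k : ℂ) := mod_cast congrArg ofReal hε
  have hrC : (r : ℂ) = tP - 1 := mod_cast congrArg ofReal hr
  have htQ' : tQ * (2 * I * J * sin (kQ : ℂ)) = lam * tP := by
    rw [htQ, ofReal_sin]
    exact div_mul_cancel₀ _ (by simp [hJC, hsQC])
  have htP' : 4 * α * J ^ 2 * Real.sin k * Real.sin kQ * (1 - tP) = lam ^ 2 * tP := by
    have hD : 0 < 4 * α * J ^ 2 * Real.sin k * Real.sin kQ := by positivity
    have hE : 4 * α * J ^ 2 * Real.sin k * Real.sin kQ + lam ^ 2 ≠ 0 := by positivity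
    rw [htP, one_add_div hD.ne', one_div_div]
    generalize 4 * α * J ^ 2 * Real.sin k * Real.sin kQ = D at hE
    field_simp
    ring
  have htPC : 4 * α * J ^ 2 * sin (k : ℂ) * sin (kQ : ℂ) * (1 - tP) = lam ^ 2 * tP :=
    mod_cast congrArg ofReal htP'
  have hP_nonpos (n : ℤ) (hn : n ≤ 0) :
      ψP n = exp (I * k * n) + r * exp (-(I * k * n)) := by rw [hψP, if_pos hn]
  have hP_nonneg (n : ℤ) (hn : 0 ≤ n) : ψP n = tP * exp (I * k * n) := by
    rcases hn.eq_or_lt with rfl | hn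
    · simp [hψP, hrC]
    · rw [hψP, if_neg hn.not_ge]
  have hQ_nonneg (n : ℤ) (hn : 0 ≤ n) : ψQ n = tQ * exp (I * kQ * n) := by
    rw [hψQ, abs_of_nonneg hn]
  have hQ_nonpos (n : ℤ) (hn : n ≤ 0) : ψQ n = tQ * exp (-(I * kQ * n)) := by
    rw [hψQ, abs_of_nonpos hn]
    simp
  have hP_one : ψP 1 = tP * (cos (k : ℂ) + sin (k : ℂ) * I) := by
    rw [hP_nonneg 1 one_pos.le, ← exp_mul_I]
    simp [mul_comm]
  have hP_neg_one : ψP (-1) = (cos (k : ℂ) - sin (k : ℂ) * I)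
      + r * (cos (k : ℂ) + sin (k : ℂ) * I) := by
    rw [hP_nonpos (-1) (by norm_num), ← exp_mul_I, cos_sub_sin_I]
    simp [mul_comm]
  have hQ_one : ψQ 1 = tQ * (cos (kQ : ℂ) + sin (kQ : ℂ) * I) := by
    rw [hψQ, ← exp_mul_I]
    simp [mul_comm]
  have hQ_neg_one : ψQ (-1) = tQ * (cos (kQ : ℂ) + sin (kQ : ℂ) * I) := by
    rw [hψQ, ← exp_mul_I]
    simp [mul_comm]
  have hP_zero : ψP 0 = tP := by simp [hP_nonneg 0 le_rfl]
  have hQ_zero : ψQ 0 = tQ := by simp [hψQ]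
  refine ⟨fun n hn => ?_, ?_, ?_⟩
  · have hp := exp_sub_one_add_exp_add_one k n
    have hm := exp_neg_sub_one_add_exp_neg_add_one k n
    have hpQ := exp_sub_one_add_exp_add_one kQ n
    have hmQ := exp_neg_sub_one_add_exp_neg_add_one kQ n
    rw [hcos] at hpQ hmQ
    rcases hn.lt_or_gt with hn | hn
    · rw [hP_nonpos (n - 1) (by lia), hP_nonpos n (by lia), hP_nonpos (n + 1) (by lia),
        hQ_nonpos (n - 1) (by lia), hQ_nonpos n (by lia), hQ_nonpos (n + 1) (by lia), hεC]
      push_cast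
      constructor
      · linear_combination -J * hp - J * r * hm
      · field_simp
        linear_combination -tQ * hmQ
    · rw [hP_nonneg (n - 1) (by lia), hP_nonneg n (by lia), hP_nonneg (n + 1) (by lia),
        hQ_nonneg (n - 1) (by lia), hQ_nonneg n (by lia), hQ_nonneg (n + 1) (by lia), hεC]
      push_cast
      constructor
      · linear_combination -J * tP * hp
      · field_simp
        linear_combination -tQ * hpQ
  · have hcoupling : lam * tQ = -(2 * I * α * J * sin (k : ℂ) * (1 - tP)) := by
      have h : 2 * I * J * sin (kQ : ℂ) ≠ 0 := by simp [hJC, hsQC]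
      refine mul_right_cancel₀ h ?_
      linear_combination lam * htQ' - htPC
        + 4 * α * J ^ 2 * sin (k : ℂ) * sin (kQ : ℂ) * (1 - tP) * I_sq
    rw [hP_one, hP_neg_one, hP_zero, hQ_zero, hεC, hrC, div_mul_eq_mul_div, hcoupling]
    field_simp
    ring
  · rw [hQ_one, hQ_neg_one, hP_zero, hQ_zero, hεC, hcos]
    field_simp
    linear_combination -htQ'
end

section
/- Suppression of scattering in the toy model (equations (24)–(25) and Appendix A): as α → 0⁺, T_P(α) → 0 and T_{P→Q}(α) → 0; more precisely T_P(α)/α² → 16 J⁴ sin²k / λ⁴, T_{P→Q}(α)/α → 8 J² sin k / λ², and t_Q(α)/α → −2iJ·sin k / λ. -/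
open Filter Topology

/-- Suppression of scattering in the toy model (equations (24)–(25) and Appendix A of
the paper): as `α → 0⁺`, both the transmission probability `T_P` within the slow chain
and the probability `T_{P→Q}` of scattering into the fast chain vanish; more precisely
`T_P(α)/α² → 16 J⁴ sin²k/λ⁴`, `T_{P→Q}(α)/α → 8 J² sin k/λ²` and
`t_Q(α)/α → −2iJ sin k/λ`. -/
theorem toy_model_suppression
    (J lam : ℝ) (hJ : 0 < J) (hlam : lam ≠ 0)
    (k : ℝ) (hk : k ∈ Set.Ioo 0 Real.pi)
    (sQ c tP TP TPQ : ℝ → ℝ) (tQ : ℝ → ℂ)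
    (hsQ : ∀ α : ℝ, sQ α = Real.sqrt (1 - α ^ 2 * Real.cos k ^ 2))
    (hc : ∀ α : ℝ, c α = lam ^ 2 / (4 * α * J ^ 2 * Real.sin k * sQ α))
    (htP : ∀ α : ℝ, tP α = 1 / (1 + c α))
    (htQ : ∀ α : ℝ, tQ α = (lam : ℂ) * (tP α : ℂ) / (2 * Complex.I * (J : ℂ) * (sQ α : ℂ)))
    (hTP : ∀ α : ℝ, TP α = |tP α| ^ 2)
    (hTPQ : ∀ α : ℝ, TPQ α = 2 * c α * TP α) :
    Tendsto TP (𝓝[>] (0:ℝ)) (𝓝 0) ∧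
    Tendsto TPQ (𝓝[>] (0:ℝ)) (𝓝 0) ∧
    Tendsto (fun α : ℝ => TP α / α ^ 2) (𝓝[>] (0:ℝ))
      (𝓝 (16 * J ^ 4 * Real.sin k ^ 2 / lam ^ 4)) ∧
    Tendsto (fun α : ℝ => TPQ α / α) (𝓝[>] (0:ℝ))
      (𝓝 (8 * J ^ 2 * Real.sin k / lam ^ 2)) ∧
    Tendsto (fun α : ℝ => tQ α / (α : ℂ)) (𝓝[>] (0:ℝ))
      (𝓝 (-2 * Complex.I * (J : ℂ) * (Real.sin k : ℂ) / (lam : ℂ))) := by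
  have hsin : 0 < Real.sin k := Real.sin_pos_of_mem_Ioo hk
  have hid : Tendsto (fun α : ℝ => α) (𝓝[>] (0:ℝ)) (𝓝 0) := nhdsWithin_le_nhds
  have hs : Tendsto sQ (𝓝[>] (0:ℝ)) (𝓝 1) := by
    have hcont : Continuous sQ := by
      rw [funext hsQ]
      fun_prop
    simpa [hsQ] using (hcont.tendsto 0).mono_left (nhdsWithin_le_nhds (s := Set.Ioi 0))
  have hspos : ∀ᶠ α in 𝓝[>] (0:ℝ), 0 < sQ α := hs.eventually_const_lt one_pos
  have hαpos : ∀ᶠ α in 𝓝[>] (0:ℝ), 0 < α := self_mem_nhdsWithin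
  have hg : Tendsto (fun α => tP α / α) (𝓝[>] (0:ℝ))
      (𝓝 (4 * J ^ 2 * Real.sin k / lam ^ 2)) := by
    have hlim := (hs.const_mul (4 * J ^ 2 * Real.sin k)).div
      (((hid.mul hs).const_mul (4 * J ^ 2 * Real.sin k)).add_const (lam ^ 2)) (by simpa)
    simp only [mul_zero, zero_add, mul_one] at hlim
    refine hlim.congr' ?_
    filter_upwards [hspos, hαpos] with α h1 h2
    have hD : 4 * J ^ 2 * Real.sin k * (α * sQ α) + lam ^ 2 ≠ 0 := by positivity
    have hc1 : 1 + c α = (4 * J ^ 2 * Real.sin k * (α * sQ α) + lam ^ 2) /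
        (4 * α * J ^ 2 * Real.sin k * sQ α) := by
      rw [hc]
      field_simp
    rw [htP, hc1, Pi.div_apply]
    field_simp
  have hTP2 : Tendsto (fun α : ℝ => TP α / α ^ 2) (𝓝[>] (0:ℝ))
      (𝓝 (16 * J ^ 4 * Real.sin k ^ 2 / lam ^ 4)) := by
    have hlim := hg.pow 2
    rw [show (4 * J ^ 2 * Real.sin k / lam ^ 2) ^ 2 =
      16 * J ^ 4 * Real.sin k ^ 2 / lam ^ 4 by ring] at hlim
    simpa only [hTP, sq_abs, div_pow] using hlim
  have hTPQ1 : Tendsto (fun α : ℝ => TPQ α / α) (𝓝[>] (0:ℝ))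
      (𝓝 (8 * J ^ 2 * Real.sin k / lam ^ 2)) := by
    have hlim := ((tendsto_const_nhds (x := 2 * lam ^ 2)).div
      (hs.const_mul (4 * J ^ 2 * Real.sin k)) (by positivity)).mul hTP2
    rw [show 2 * lam ^ 2 / (4 * J ^ 2 * Real.sin k * 1) *
        (16 * J ^ 4 * Real.sin k ^ 2 / lam ^ 4) = 8 * J ^ 2 * Real.sin k / lam ^ 2 by
      field_simp; norm_num] at hlim
    refine hlim.congr' ?_
    filter_upwards [hspos, hαpos] with α h1 h2
    rw [Pi.div_apply, hTPQ, hc]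
    field_simp
  refine ⟨?_, ?_, hTP2, hTPQ1, ?_⟩
  · have hlim := hTP2.mul (hid.pow 2)
    rw [zero_pow two_ne_zero, mul_zero] at hlim
    refine hlim.congr' ?_
    filter_upwards [hαpos] with α h2
    field_simp
  · have hlim := hTPQ1.mul hid
    rw [mul_zero] at hlim
    refine hlim.congr' ?_
    filter_upwards [hαpos] with α h2
    field_simp
  · have hlim := ((Complex.continuous_ofReal.tendsto _).comp
      ((hg.const_mul lam).div (hs.const_mul (2 * J)) (by positivity))).const_mul (-Complex.I)
    have hlamC : (lam : ℂ) ≠ 0 := by exact_mod_cast hlam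
    have hJC : (J : ℂ) ≠ 0 := by exact_mod_cast hJ.ne'
    convert hlim using 2
    · rw [htQ, Function.comp_apply, Pi.div_apply]
      push_cast
      simp only [div_eq_mul_inv, mul_inv, Complex.inv_I]
      ring
    · push_cast
      field_simp
      ring
end

section
/- Exact solution of the toy model for an incoming particle in the fast chain (Appendix B): the pair (ψ_P, ψ_Q) is a generalized eigenfunction of the toy-model Hamiltonian with eigenvalue ε; that is, for every n ∈ ℤ with n ≠ 0: −J·(ψ_P(n−1) + ψ_P(n+1)) = ε·ψ_P(n) and −(J/α)·(ψ_Q(n−1) + ψ_Q(n+1)) = ε·ψ_Q(n), and at n = 0: −J·(ψ_P(−1) + ψ_P(1)) + (λ/α)·ψ_Q(0) = ε·ψ_P(0) and −(J/α)·(ψ_Q(−1) + ψ_Q(1)) + (λ/α)·ψ_P(0) = ε·ψ_Q(0). -/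
open Complex

/-- The two plane waves of momentum `q` and `-q` both satisfy the free hopping recurrence. -/
theorem plane_wave_superposition_recurrence {a b q : ℂ} {f : ℤ → ℂ} {n : ℤ}
    (h : ∀ m : ℤ, |m - n| ≤ 1 →
      f m = a * exp (I * q * (m : ℂ)) + b * exp (-(I * q * (m : ℂ)))) :
    f (n - 1) + f (n + 1) = 2 * cos q * f n := by
  rw [h (n - 1) (by simp), h (n + 1) (by simp), h n (by simp)]
  have h₁ := exp_sub_one_add_exp_add_one q n
  have h₂ := exp_sub_one_add_exp_add_one (-q) n
  rw [cos_neg] at h₂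
  simp only [mul_neg, neg_mul] at h₂
  push_cast
  linear_combination a * h₁ + b * h₂

/-- Exact solution of the toy model for an incoming particle in the fast chain
(Appendix B of the paper): the pair `(ψ_P, ψ_Q)` is a generalized eigenfunction,
with eigenvalue `ε = −(2J/α) cos k`, of the toy-model Hamiltonian consisting of two
tight-binding chains `P` and `Q` with hopping amplitudes `J` and `J/α` coupled at
site `0` with amplitude `λ/α`, for an incoming plane wave of momentum `k` in the
fast chain `Q`. -/
theorem toy_model_scattering_state_fast_chain
    (J lam : ℝ) (hJ : J ≠ 0) (α : ℝ) (hα : α ∈ Set.Ioo (0:ℝ) 1)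
    (k : ℝ) (hk : k ∈ Set.Ioo 0 Real.pi)
    (kP : ℂ) (hkP : Complex.cos kP = (Real.cos k : ℂ) / (α : ℂ))
    (hsinkP : Complex.sin kP ≠ 0)
    (ε : ℝ) (hε : ε = -(2 * J / α) * Real.cos k)
    (hden : (1 : ℂ)
      + (lam : ℂ) ^ 2 / (4 * (α : ℂ) * (J : ℂ) ^ 2 * Complex.sin kP * (Real.sin k : ℂ))
      ≠ 0)
    (tQ rQ tP : ℂ)
    (htQ : tQ = 1 / (1
      + (lam : ℂ) ^ 2 / (4 * (α : ℂ) * (J : ℂ) ^ 2 * Complex.sin kP * (Real.sin k : ℂ))))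
    (hrQ : rQ = tQ - 1)
    (htP : tP = (lam : ℂ) * tQ / (2 * Complex.I * (α : ℂ) * (J : ℂ) * Complex.sin kP))
    (ψQ ψP : ℤ → ℂ)
    (hψQ : ∀ n : ℤ, ψQ n =
      if n ≤ 0 then
        Complex.exp (Complex.I * (k : ℂ) * (n : ℂ))
          + rQ * Complex.exp (-(Complex.I * (k : ℂ) * (n : ℂ)))
      else tQ * Complex.exp (Complex.I * (k : ℂ) * (n : ℂ)))
    (hψP : ∀ n : ℤ, ψP n = tP * Complex.exp (Complex.I * kP * ((|n| : ℤ) : ℂ))) :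
    (∀ n : ℤ, n ≠ 0 →
      -(J : ℂ) * (ψP (n - 1) + ψP (n + 1)) = (ε : ℂ) * ψP n ∧
      -((J : ℂ) / (α : ℂ)) * (ψQ (n - 1) + ψQ (n + 1)) = (ε : ℂ) * ψQ n) ∧
    -(J : ℂ) * (ψP (-1) + ψP 1) + ((lam : ℂ) / (α : ℂ)) * ψQ 0 = (ε : ℂ) * ψP 0 ∧
    -((J : ℂ) / (α : ℂ)) * (ψQ (-1) + ψQ 1) + ((lam : ℂ) / (α : ℂ)) * ψP 0
      = (ε : ℂ) * ψQ 0 := by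
  have hα0 : (α : ℂ) ≠ 0 := by exact_mod_cast hα.1.ne'
  have hJ0 : (J : ℂ) ≠ 0 := by exact_mod_cast hJ
  have hsink : Complex.sin (k : ℂ) ≠ 0 := by
    exact_mod_cast (Real.sin_pos_of_mem_Ioo hk).ne'
  have hεP : (ε : ℂ) = -(J : ℂ) * (2 * Complex.cos kP) := by
    rw [hε, hkP]
    push_cast
    ring
  have hεQ : (ε : ℂ) = -((J : ℂ) / (α : ℂ)) * (2 * Complex.cos (k : ℂ)) := by
    rw [hε]
    push_cast
    ring
  have htP' : 2 * I * (J : ℂ) * Complex.sin kP * tP = (lam : ℂ) / (α : ℂ) * tQ := by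
    rw [htP]
    field_simp
  have hrQ' : 2 * I * ((J : ℂ) / (α : ℂ)) * Complex.sin (k : ℂ) * rQ
      = (lam : ℂ) / (α : ℂ) * tP := by
    have hmul : tQ * (1 + (lam : ℂ) ^ 2 /
        (4 * (α : ℂ) * (J : ℂ) ^ 2 * Complex.sin kP * (Real.sin k : ℂ))) = 1 := by
      rw [htQ, one_div, inv_mul_cancel₀ hden]
    have hr : rQ = -(tQ * ((lam : ℂ) ^ 2 /
        (4 * (α : ℂ) * (J : ℂ) ^ 2 * Complex.sin kP * Complex.sin (k : ℂ)))) := by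
      rw [hrQ]
      push_cast at hmul
      linear_combination hmul
    rw [hr, htP]
    field_simp
    rw [I_sq]
    ring
  have hQneg : ∀ n : ℤ, n ≤ 0 →
      ψQ n = 1 * exp (I * k * (n : ℂ)) + rQ * exp (-(I * k * (n : ℂ))) := by
    intro n hn
    rw [hψQ, if_pos hn, one_mul]
  have hQpos : ∀ n : ℤ, 0 ≤ n →
      ψQ n = tQ * exp (I * k * (n : ℂ)) + 0 * exp (-(I * k * (n : ℂ))) := by
    intro n hn
    rcases hn.eq_or_lt with rfl | hn
    · rw [hQneg 0 le_rfl, hrQ]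
      simp
    · rw [hψQ, if_neg hn.not_ge, zero_mul, add_zero]
  refine ⟨fun n hn => ⟨?_, ?_⟩, ?_, ?_⟩
  · have hrec : ψP (n - 1) + ψP (n + 1) = 2 * Complex.cos kP * ψP n := by
      rcases hn.lt_or_gt with hn | hn
      · refine plane_wave_superposition_recurrence (a := 0) (b := tP) fun m hm => ?_
        rw [hψP, abs_of_nonpos (by grind)]
        push_cast
        simp
      · refine plane_wave_superposition_recurrence (a := tP) (b := 0) fun m hm => ?_
        rw [hψP, abs_of_nonneg (by grind)]
        simp
    rw [hrec, hεP]
    ring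
  · have hrec : ψQ (n - 1) + ψQ (n + 1) = 2 * Complex.cos (k : ℂ) * ψQ n := by
      rcases hn.lt_or_gt with hn | hn
      · exact plane_wave_superposition_recurrence fun m hm => hQneg m (by grind)
      · exact plane_wave_superposition_recurrence fun m hm => hQpos m (by grind)
    rw [hrec, hεQ]
    ring
  · have hψP0 : ψP 0 = tP := by simp [hψP]
    have hψP1 : ψP 1 = tP * (Complex.cos kP + Complex.sin kP * I) := by
      simp [hψP, ← exp_mul_I, mul_comm I]
    have hψPneg : ψP (-1) = ψP 1 := by simp [hψP]
    have hψQ0 : ψQ 0 = tQ := by simp [hQpos 0 le_rfl]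
    rw [hψPneg, hψP1, hψP0, hψQ0, hεP]
    linear_combination -htP'
  · have hψP0 : ψP 0 = tP := by simp [hψP]
    have hψQ0 : ψQ 0 = tQ := by simp [hQpos 0 le_rfl]
    have hexp : exp (I * k) = Complex.cos (k : ℂ) + Complex.sin (k : ℂ) * I := by
      rw [mul_comm, exp_mul_I]
    have hexpneg : exp (-(I * k)) = Complex.cos (k : ℂ) - Complex.sin (k : ℂ) * I := by
      rw [mul_comm, ← neg_mul, exp_mul_I, cos_neg, sin_neg, neg_mul, sub_eq_add_neg]
    have hψQ1 : ψQ 1 = tQ * (Complex.cos (k : ℂ) + Complex.sin (k : ℂ) * I) := by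
      simp [hQpos 1 zero_le_one, hexp]
    have hψQneg : ψQ (-1) = (Complex.cos (k : ℂ) - Complex.sin (k : ℂ) * I)
        + rQ * (Complex.cos (k : ℂ) + Complex.sin (k : ℂ) * I) := by
      simp [hQneg (-1) (by simp), hexp, hexpneg]
    have htQr : tQ = 1 + rQ := by rw [hrQ]; ring
    rw [hψQneg, hψQ1, hψP0, hψQ0, hεQ, htQr]
    linear_combination -hrQ'
end
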